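/- Let k be a field with char(k) = 0 or char(k) > m, where m ≥ 1. Let C be a symmetric rigid monoidal category over k with End(1) = k, and let X be an object of C of dimension d := ẽv_X ∘ coev_X ∈ k. Identify S_{m-1} with the stabilizer of 1 in S_m. Let V_α be an irreducible representation of S_{m-1} over k with character χ_α, let V_β be an irreducible representation of S_m over k with character χ_β, and let e_α = (dim V_α/(m-1)!) Σ_{τ∈S_{m-1}} χ_α(τ) τ and e_β = (dim V_β/m!) Σ_{σ∈S_m} χ_β(σ) σ be the associated primitive central idempotents of the group algebras. Assume the multiplicity of V_α in the restriction of V_β from S_m to S_{m-1} equals 1, i.e., (1/(m-1)!) Σ_{τ∈S_{m-1}} χ_α(τ) χ_β(τ^{-1}) = 1. Then Tr^{X^{⊗(m-1)}}_{X,X}((id_X ⊗ ρ'(e_α)) ∘ ρ(e_β)) = ((dim V_α / m!) Σ_{σ∈S_m} χ_β(σ) d^{N(σ)-1}) · id_X. -/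

import Mathlib

open CategoryTheory MonoidalCategory

variable {C : Type*} [Category C] [MonoidalCategory C]

/-- The `n`-th tensor power `X^{⊗n}` of an object of a monoidal category. -/
def tpow (X : C) : ℕ → C
  | 0 => 𝟙_ C
  | n + 1 => X ⊗ tpow X n

/-- The braiding of the `i`-th and `(i+1)`-th tensor factors of `X^{⊗m}`
(positions `0`-indexed). -/
def adjSwap [BraidedCategory C] (X : C) : (m : ℕ) → ℕ → (tpow X m ⟶ tpow X m)
  | 0, _ => 𝟙 _
  | 1, _ => 𝟙 _
  | m + 2, 0 =>
      (α_ X X (tpow X m)).inv ≫ ((β_ X X).hom ▷ tpow X m) ≫ (α_ X X (tpow X m)).hom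
  | m + 2, i + 1 => X ◁ adjSwap X (m + 1) i

/-- `ρ : S_m →* End (X^{⊗m})` is *the* action of the symmetric group permuting the
tensor factors via the symmetry iff it sends each adjacent transposition `(i, i+1)` to
the braiding of the corresponding adjacent tensor factors (these transpositions generate
`S_m`, so this characterizes the action uniquely). -/
def IsPermAction [BraidedCategory C] (X : C) (m : ℕ)
    (ρ : Equiv.Perm (Fin m) →* CategoryTheory.End (tpow X m)) : Prop :=
  ∀ (i : ℕ) (h : i + 1 < m),
    ρ (Equiv.swap ⟨i, Nat.lt_of_succ_lt h⟩ ⟨i + 1, h⟩) = adjSwap X m i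

/-- The partial trace `Tr^U_{A,B}(f) := (id_B ⊗ ẽv_U) ∘ (f ⊗ id_{U*}) ∘ (id_A ⊗ coev_U)`
of `f : A ⊗ U ⟶ B ⊗ U` in a symmetric rigid monoidal category, where
`ẽv_U := ev_U ∘ c_{U,U*}`. -/
def ptrace [SymmetricCategory C] [RigidCategory C] (A B U : C) (f : A ⊗ U ⟶ B ⊗ U) :
    A ⟶ B :=
  (ρ_ A).inv ≫ (A ◁ η_ U (Uᘁ)) ≫ (α_ A U (Uᘁ)).inv ≫ (f ▷ (Uᘁ)) ≫
    (α_ B U (Uᘁ)).hom ≫ (B ◁ ((β_ U (Uᘁ)).hom ≫ ε_ U (Uᘁ))) ≫ (ρ_ B).hom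
/-- The embedding of `S_m` into `S_{m+1}` as the stabilizer of the first point `0`. -/
def embSucc (m : ℕ) : Equiv.Perm (Fin m) →* Equiv.Perm (Fin (m + 1)) where
  toFun τ := (finSuccEquiv m).symm.permCongr τ.optionCongr
  map_one' := by ext x; simp
  map_mul' τ₁ τ₂ := by ext x; simp [Equiv.permCongr_apply]
/-- The number of disjoint cycles of a permutation of `Fin m`, counting fixed points as
cycles (i.e. the number of orbits): the number of nontrivial cycles plus the number of
fixed points. -/
def numCycles {m : ℕ} (σ : Equiv.Perm (Fin m)) : ℕ :=
  Multiset.card σ.cycleType + (m - σ.cycleType.sum)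

namespace Equiv.Perm

variable {m : ℕ}

lemma embSucc_apply_zero (τ : Perm (Fin m)) : embSucc m τ 0 = 0 := by
  simp [embSucc]

lemma embSucc_apply_succ (τ : Perm (Fin m)) (i : Fin m) : embSucc m τ i.succ = (τ i).succ := by
  simp [embSucc]

lemma decomposeFin_symm_eq_swap_mul (p : Fin (m + 1)) (e : Perm (Fin m)) :
    decomposeFin.symm (p, e) = swap 0 p * embSucc m e := by
  ext x
  refine Fin.cases ?_ (fun i => ?_) x
  · simp [embSucc_apply_zero]
  · simp [embSucc_apply_succ]

lemma embSucc_swap (i j : Fin m) : embSucc m (swap i j) = swap i.succ j.succ := by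
  ext x
  refine Fin.cases ?_ (fun l => ?_) x
  · rw [embSucc_apply_zero, swap_apply_of_ne_of_ne (Fin.succ_ne_zero _).symm
      (Fin.succ_ne_zero _).symm]
  · rw [embSucc_apply_succ, Function.Injective.map_swap (Fin.succ_injective m)]

lemma cycleType_embSucc (τ : Perm (Fin m)) : (embSucc m τ).cycleType = τ.cycleType := by
  have h : embSucc m τ = τ.extendDomain (finSuccAboveEquiv 0) := by
    ext x
    refine Fin.cases ?_ (fun i => ?_) x
    · rw [embSucc_apply_zero, extendDomain_apply_not_subtype _ _ (by simp)]
    · rw [embSucc_apply_succ]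
      have := extendDomain_apply_image τ (finSuccAboveEquiv (0 : Fin (m + 1))) i
      rw [finSuccAboveEquiv_apply, finSuccAboveEquiv_apply] at this
      simpa only [Fin.zero_succAbove] using congrArg Fin.val this.symm
  rw [h, cycleType_extendDomain]

lemma numCycles_embSucc (τ : Perm (Fin m)) : numCycles (embSucc m τ) = numCycles τ + 1 := by
  have := τ.sum_cycleType_le
  rw [Fintype.card_fin] at this
  simp only [numCycles, cycleType_embSucc]
  omega

lemma numCycles_conj (σ τ : Perm (Fin m)) : numCycles (τ * σ * τ⁻¹) = numCycles σ := by
  simp only [numCycles, cycleType_conj]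

lemma numCycles_swap_mul (g : Perm (Fin m)) (x : Fin m) (hx : g x ≠ x) :
    numCycles (swap x (g x) * g) = numCycles g + 1 := by
  obtain ⟨c, hc⟩ : ∃ c, c = g.cycleOf x := ⟨_, rfl⟩
  obtain ⟨r, hr⟩ : ∃ r, r = g * c⁻¹ := ⟨_, rfl⟩
  have hcyc : c.IsCycle := hc ▸ isCycle_cycleOf g hx
  have hcx : c x = g x := hc ▸ cycleOf_apply_self g x
  have hdisj : Disjoint c r := by
    have := disjoint_mul_inv_of_mem_cycleFactorsFinset
      (cycleOf_mem_cycleFactorsFinset_iff.2 (mem_support.2 hx))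
    rw [← hc, ← hr] at this
    exact this.symm
  have hg : g = c * r := by rw [hdisj.commute.eq, hr]; group
  have hdisj' : Disjoint (swap x (c x) * c) r := by
    rw [disjoint_iff_disjoint_support] at hdisj ⊢
    exact hdisj.mono_left fun y hy => (mem_support_swap_mul_imp_mem_support_ne hy).1
  have hct : g.cycleType = {c.support.card} + r.cycleType := by
    rw [hg, hdisj.cycleType_mul, hcyc.cycleType]
  have hle := g.sum_cycleType_le
  rw [hct, Fintype.card_fin, Multiset.sum_add, Multiset.sum_singleton] at hle
  rw [← hcx] at hx ⊢
  simp only [numCycles, hct]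
  rw [hg, ← mul_assoc, hdisj'.cycleType_mul]
  by_cases hccx : c (c x) = x
  · have h1 := hcyc.eq_swap_of_apply_apply_eq_self hx hccx
    have h2 : swap x (c x) * c = 1 := by
      nth_rewrite 2 [h1]
      exact swap_mul_self _ _
    have h3 : c.support.card = 2 := by
      rw [h1, card_support_swap hx.symm]
    simp only [h2, h3, cycleType_one, Multiset.sum_add, Multiset.sum_singleton, Multiset.card_add,
      Multiset.card_singleton, zero_add] at hle ⊢
    omega
  · have h1 := hcyc.swap_mul hx hccx
    have h2 := Finset.card_sdiff_add_card_inter c.support {x}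
    rw [← support_swap_mul_eq c x hccx, Finset.inter_singleton_of_mem (mem_support.2 hx),
      Finset.card_singleton] at h2
    simp only [h1.cycleType, Multiset.sum_add, Multiset.sum_singleton, Multiset.card_add,
      Multiset.card_singleton]
    omega

lemma numCycles_swap_mul_embSucc (i : Fin m) (τ : Perm (Fin m)) :
    numCycles (swap 0 i.succ * embSucc m τ) = numCycles τ := by
  have h := numCycles_swap_mul (swap 0 i.succ * embSucc m τ) 0 (by
    simp [embSucc_apply_zero, Fin.succ_ne_zero])
  rw [mul_apply, embSucc_apply_zero, swap_apply_left, swap_mul_self_mul, numCycles_embSucc] at h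
  omega

lemma numCycles_pos (σ : Perm (Fin (m + 1))) : 0 < numCycles σ := by
  induction m with
  | zero =>
    have : σ = 1 := Equiv.ext fun x => Subsingleton.elim (α := Fin 1) _ _
    simp [this, numCycles]
  | succ m ih =>
    obtain ⟨⟨p, e⟩, rfl⟩ := decomposeFin.symm.surjective σ
    rw [decomposeFin_symm_eq_swap_mul]
    refine Fin.cases ?_ (fun i => ?_) p
    · rw [swap_self, ← one_def, one_mul, numCycles_embSucc]
      omega
    · rw [numCycles_swap_mul_embSucc]
      exact ih e

end Equiv.Perm

section JucysMurphy

open Polynomial Equiv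

/-- The relation `Y = s Y' s + s` with `s² = 1` and `Y`, `Y'` commuting turns a polynomial
relation for `Y'` into one for `Y`. -/
lemma aeval_mul_one_sub_sq_eq_zero {k A : Type*} [Field k] [Ring A] [Algebra k A] {s Y Y' : A}
    (hs : s * s = 1) (hY : Y = s * Y' * s + s) (hc : Commute Y Y') {p : k[X]}
    (hp : aeval Y' p = 0) : aeval Y p * (1 - (Y - Y') * (Y - Y')) = 0 := by
  obtain ⟨f, hf⟩ : ∃ f, f = s * (Y' - Y) + 1 := ⟨_, rfl⟩
  have hYs : Y * s = s * Y' + 1 := by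
    rw [hY, add_mul, mul_assoc _ s s, hs, mul_one]
  have hsY : s * Y = Y' * s + 1 := by
    rw [hY, mul_add, ← mul_assoc, ← mul_assoc, hs, one_mul]
  have hsYs : s * Y' * s = Y - s := by rw [hY]; abel
  have hfY : Y * f = f * Y' := by
    have h1 : Y * (s * (Y' - Y)) = (s * Y' + 1) * (Y' - Y) := by rw [← mul_assoc, hYs]
    have h2 : Y' * (Y' - Y) = (Y' - Y) * Y' := by
      rw [mul_sub, sub_mul, hc.eq]
    rw [hf, mul_add, h1, add_mul, add_mul, mul_assoc s Y', h2, ← mul_assoc, one_mul, one_mul,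
      mul_one]
    abel
  have hff : f * f = 1 - (Y - Y') * (Y - Y') := by
    have h1 : f * s = Y - Y' - s := by
      rw [hf, add_mul, one_mul, mul_sub, sub_mul, hsYs, hsY, add_mul, mul_assoc, hs, mul_one,
        one_mul]
      abel
    nth_rewrite 2 [hf]
    rw [mul_add, ← mul_assoc, h1, mul_one, hf]
    noncomm_ring
  have hpf (q : k[X]) : aeval Y q * f = f * aeval Y' q := by
    induction q using Polynomial.induction_on' with
    | add p q hp hq => rw [map_add, map_add, add_mul, mul_add, hp, hq]
    | monomial n a =>
      have : SemiconjBy f (Y' ^ n) (Y ^ n) := SemiconjBy.pow_right hfY.symm n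
      rw [aeval_monomial, aeval_monomial, mul_assoc, ← this.eq, Algebra.left_comm]
  rw [← hff, ← mul_assoc, hpf, hp, mul_zero, zero_mul]

lemma aeval_mul_comp_mul_comp_eq_zero {k B : Type*} [Field k] [CommRing B] [Algebra k B]
    {y y' : B} {p : k[X]} (hp' : aeval y' p = 0)
    (hp : aeval y p * (1 - (y - y') * (y - y')) = 0) :
    aeval y (p * p.comp (X - Polynomial.C 1) * p.comp (X - Polynomial.C (-1))) = 0 := by
  have key (b : B) : b - y' ∣ aeval b p := by
    have := sub_dvd_eval_sub b y' (p.map (algebraMap k B))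
    rwa [eval_map_algebraMap, eval_map_algebraMap, hp', sub_zero] at this
  obtain ⟨u, hu⟩ := key (y - 1)
  obtain ⟨v, hv⟩ := key (y + 1)
  simp only [map_mul, aeval_comp, map_sub, map_add, aeval_X,
    map_one, map_neg, sub_neg_eq_add, hu, hv]
  linear_combination (-u * v) * hp

/-- If `Y = s Y' s + s` with `s² = 1`, if `Y`, `Y'` commute and if `Y'` is annihilated by a
split polynomial, then so is `Y`. -/
lemma exists_splits_aeval_eq_zero {k A : Type*} [Field k] [Ring A] [Algebra k A] {s Y Y' : A}
    (hs : s * s = 1) (hY : Y = s * Y' * s + s) (hc : Commute Y Y')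
    (h : ∃ p : k[X], p ≠ 0 ∧ p.Splits ∧ aeval Y' p = 0) :
    ∃ p : k[X], p ≠ 0 ∧ p.Splits ∧ aeval Y p = 0 := by
  obtain ⟨p, hp0, hps, hp⟩ := h
  have hcomp (a : k) : p.comp (X - Polynomial.C a) ≠ 0 := by
    rw [sub_eq_add_neg, ← Polynomial.C_neg]
    exact comp_X_add_C_ne_zero_iff.2 hp0
  refine ⟨p * p.comp (X - Polynomial.C 1) * p.comp (X - Polynomial.C (-1)),
    mul_ne_zero (mul_ne_zero hp0 (hcomp _)) (hcomp _),
    (hps.mul (hps.comp_X_sub_C _)).mul (hps.comp_X_sub_C _), ?_⟩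
  have hcomm : IsMulCommutative (Algebra.adjoin k {Y, Y'}) := Algebra.isMulCommutative_adjoin k (by
    rintro a (rfl | rfl) b (rfl | rfl)
    exacts [rfl, hc.eq, hc.eq.symm, rfl])
  let _ : CommRing (Algebra.adjoin k {Y, Y'}) := { mul_comm := hcomm.is_comm.comm }
  let y : Algebra.adjoin k {Y, Y'} := ⟨Y, Algebra.subset_adjoin (by simp)⟩
  let y' : Algebra.adjoin k {Y, Y'} := ⟨Y', Algebra.subset_adjoin (by simp)⟩
  have hinj : Function.Injective (Algebra.adjoin k {Y, Y'}).val := Subtype.val_injective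
  have hval (z : Algebra.adjoin k {Y, Y'}) (q : k[X]) :
      (Algebra.adjoin k {Y, Y'}).val (aeval z q) = aeval (z : A) q := by
    rw [← aeval_algHom_apply]; rfl
  have := aeval_mul_comp_mul_comp_eq_zero (y := y) (y' := y') (p := p)
    (hinj (by rw [hval]; simpa using hp))
    (hinj (by
      have := aeval_mul_one_sub_sq_eq_zero hs hY hc hp
      rw [map_mul, hval]; simpa using this))
  rw [← hval y, this, map_zero]

variable {A : Type*} [Ring A]

/-- The image of the Jucys-Murphy element `∑ᵢ (0 i)` of the group ring of `S_{m+1}`. -/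
def jucysMurphy {m : ℕ} (φ : Perm (Fin (m + 1)) →* A) : A :=
  ∑ i : Fin m, φ (swap 0 i.succ)

lemma commute_jucysMurphy_embSucc {m : ℕ} (φ : Perm (Fin (m + 1)) →* A) (τ : Perm (Fin m)) :
    Commute (jucysMurphy φ) (φ (embSucc m τ)) := by
  rw [Commute, SemiconjBy, jucysMurphy, Finset.sum_mul, Finset.mul_sum,
    ← Equiv.sum_comp τ (fun i => φ (swap 0 i.succ) * _)]
  refine Finset.sum_congr rfl fun i _ => ?_
  rw [← map_mul, ← map_mul]
  have := swap_apply_apply (embSucc m τ) 0 i.succ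
  rw [Perm.embSucc_apply_zero, Perm.embSucc_apply_succ] at this
  rw [this, inv_mul_cancel_right]

lemma jucysMurphy_succ {m : ℕ} (φ : Perm (Fin (m + 2)) →* A) :
    jucysMurphy φ = φ (swap 0 1) * jucysMurphy (φ.comp (embSucc (m + 1))) * φ (swap 0 1) +
      φ (swap 0 1) := by
  rw [jucysMurphy, jucysMurphy, Fin.sum_univ_succ, add_comm, Finset.mul_sum, Finset.sum_mul]
  congr 1
  refine Finset.sum_congr rfl fun i _ => ?_
  rw [MonoidHom.comp_apply, ← map_mul, ← map_mul, Perm.embSucc_swap]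
  congr 1
  have := swap_apply_apply (swap (0 : Fin (m + 2)) 1) 1 i.succ.succ
  rw [swap_apply_right, swap_apply_of_ne_of_ne (Fin.succ_ne_zero _)
    (by rw [← Fin.succ_zero_eq_one, Ne, Fin.succ_inj]; exact Fin.succ_ne_zero _), swap_inv] at this
  exact this

lemma exists_splits_aeval_jucysMurphy {k : Type*} [Field k] [Algebra k A] {m : ℕ}
    (φ : Perm (Fin (m + 1)) →* A) :
    ∃ p : k[X], p ≠ 0 ∧ p.Splits ∧ aeval (jucysMurphy φ) p = 0 := by
  induction m with
  | zero => exact ⟨X, X_ne_zero, Splits.X, by simp [jucysMurphy]⟩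
  | succ m ih =>
    refine exists_splits_aeval_eq_zero ?_ (jucysMurphy_succ φ) ?_ (ih _)
    · rw [← map_mul, swap_mul_self, map_one]
    · exact Commute.sum_right _ _ _ fun i _ => commute_jucysMurphy_embSucc φ _

/-- The image of the element `∑_g d ^ (N(g) - 1) g` of the group algebra of `S_{m+1}`. -/
def cycleSum {k : Type*} [Field k] [Algebra k A] (d : k) {m : ℕ}
    (φ : Perm (Fin (m + 1)) →* A) : A :=
  ∑ g, d ^ (numCycles g - 1) • φ g

lemma cycleSum_succ {k : Type*} [Field k] [Algebra k A] (d : k) {m : ℕ}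
    (φ : Perm (Fin (m + 2)) →* A) :
    cycleSum d φ = (d • 1 + jucysMurphy φ) * cycleSum d (φ.comp (embSucc (m + 1))) := by
  rw [cycleSum, ← Equiv.sum_comp Perm.decomposeFin.symm, Fintype.sum_prod_type,
    Fin.sum_univ_succ, add_mul]
  congr 1
  · rw [cycleSum, Finset.mul_sum]
    refine Finset.sum_congr rfl fun e _ => ?_
    have := Perm.numCycles_pos e
    rw [Perm.decomposeFin_symm_eq_swap_mul, swap_self, ← Perm.one_def, one_mul,
      Perm.numCycles_embSucc, MonoidHom.comp_apply, smul_mul_smul_comm, one_mul, ← pow_succ']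
    congr 2
    omega
  · rw [jucysMurphy, Finset.sum_mul]
    refine Finset.sum_congr rfl fun i _ => ?_
    rw [cycleSum, Finset.mul_sum]
    refine Finset.sum_congr rfl fun e _ => ?_
    rw [Perm.decomposeFin_symm_eq_swap_mul, Perm.numCycles_swap_mul_embSucc, map_mul,
      mul_smul_comm, MonoidHom.comp_apply]

lemma commute_cycleSum {k : Type*} [Field k] [Algebra k A] (d : k) {m : ℕ}
    (φ : Perm (Fin (m + 1)) →* A) (h : Perm (Fin (m + 1))) : Commute (cycleSum d φ) (φ h) := by
  rw [Commute, SemiconjBy, cycleSum, Finset.sum_mul, Finset.mul_sum,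
    ← Equiv.sum_comp (MulAut.conj h).toEquiv]
  refine Finset.sum_congr rfl fun g _ => ?_
  simp only [MulEquiv.toEquiv_eq_coe, MulAut.conj_apply, EquivLike.coe_coe]
  rw [Perm.numCycles_conj, smul_mul_assoc, mul_smul_comm, ← map_mul, ← map_mul,
    inv_mul_cancel_right]

open Module in
lemma exists_hasEigenvalue_of_splits {k V : Type*} [Field k] [AddCommGroup V] [Module k V]
    [FiniteDimensional k V] [Nontrivial V] (f : End k V)
    (h : ∃ p : k[X], p ≠ 0 ∧ p.Splits ∧ aeval f p = 0) : ∃ a, f.HasEigenvalue a := by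
  obtain ⟨p, hp0, hps, hp⟩ := h
  have hm : (minpoly k f).Splits := hps.of_dvd hp0 (minpoly.dvd k f hp)
  obtain ⟨a, ha⟩ := hm.exists_eval_eq_zero
    (minpoly.degree_pos (Algebra.IsIntegral.isIntegral f)).ne'
  exact ⟨a, Module.End.hasEigenvalue_of_isRoot ha⟩

open Module in
/-- The element `∑_g d ^ (N(g) - 1) g` has an eigenvalue in every nonzero representation. -/
lemma exists_cycleSum_apply_eq_smul {k : Type*} [Field k] (d : k) {m : ℕ} {V : Type*}
    [AddCommGroup V] [Module k V] [FiniteDimensional k V] [Nontrivial V]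
    (φ : Perm (Fin (m + 1)) →* End k V) :
    ∃ (c : k) (v : V), v ≠ 0 ∧ cycleSum d φ v = c • v := by
  induction m generalizing V with
  | zero =>
    obtain ⟨v, hv⟩ := exists_ne (0 : V)
    refine ⟨1, v, hv, ?_⟩
    have h1 (σ : Perm (Fin (0 + 1))) : σ = 1 :=
      Equiv.ext fun x => Subsingleton.elim (α := Fin 1) _ _
    have : (Finset.univ : Finset (Perm (Fin (0 + 1)))) = {1} := by
      ext σ; simp [h1 σ]
    rw [cycleSum, this]
    simp [numCycles]
  | succ m ih =>
    obtain ⟨a, ha⟩ := exists_hasEigenvalue_of_splits (jucysMurphy φ)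
      (exists_splits_aeval_jucysMurphy φ)
    let W := End.eigenspace (jucysMurphy φ) a
    have hW (τ : Perm (Fin (m + 1))) : ∀ w ∈ W, φ (embSucc (m + 1) τ) w ∈ W := by
      intro w hw
      rw [End.mem_eigenspace_iff] at hw ⊢
      have := congrArg (fun f : End k V => f w) (commute_jucysMurphy_embSucc φ τ).eq
      simp only [End.mul_apply, hw, map_smul] at this
      exact this
    let ψ : Perm (Fin (m + 1)) →* End k W :=
      { toFun := fun τ => (φ (embSucc (m + 1) τ)).restrict (hW τ)
        map_one' := by ext; simp
        map_mul' := fun _ _ => by ext; simp }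
    have : Nontrivial W := (Submodule.nontrivial_iff_ne_bot).2 ha
    obtain ⟨c, w, hw0, hw⟩ := ih ψ
    refine ⟨(d + a) * c, w, by simpa using hw0, ?_⟩
    have h1 : cycleSum d (φ.comp (embSucc (m + 1))) (w : V) = (cycleSum d ψ w : W) := by
      simp [cycleSum, ψ, LinearMap.sum_apply]
    have h2 := End.mem_eigenspace_iff.1 w.2
    rw [cycleSum_succ, End.mul_apply, h1, hw]
    simp [h2, mul_smul, add_smul, smul_add, smul_comm c]

/-- The element `∑_g d ^ (N(g) - 1) g` acts on simple representations by scalars. -/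
lemma exists_cycleSum_eq_smul {k : Type} [Field k] (d : k) {m : ℕ}
    (V : FDRep k (Perm (Fin (m + 1)))) [Simple V] : ∃ c : k, cycleSum d V.ρ = c • 1 := by
  have : Nontrivial V := by
    by_contra h
    rw [not_nontrivial_iff_subsingleton] at h
    apply id_nonzero V
    ext x
    exact Subsingleton.elim (α := V) _ _
  obtain ⟨c, v, hv0, hv⟩ := exists_cycleSum_apply_eq_smul d V.ρ
  refine ⟨c, ?_⟩
  let f : V ⟶ V :=
    { hom := FGModuleCat.ofHom (cycleSum d V.ρ - c • 1)
      comm := fun g => by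
        ext x
        have := congrArg (fun f : Module.End k V => f x) (commute_cycleSum d V.ρ g).eq
        change cycleSum d V.ρ (V.ρ g x) - c • V.ρ g x = V.ρ g (cycleSum d V.ρ x - c • x)
        rw [map_sub, map_smul]
        exact congrArg (· - c • V.ρ g x) this }
  have hfx (x : V) : f.hom.hom.hom x = cycleSum d V.ρ x - c • x := rfl
  by_cases hf : f = 0
  · ext x
    have := hfx x
    rw [hf] at this
    exact (sub_eq_zero.1 this.symm)
  · have := isIso_of_hom_simple hf
    refine absurd ?_ hv0
    have h1 := congrArg (fun g : V ⟶ V => g.hom.hom.hom v) (IsIso.hom_inv_id f)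
    change (inv f).hom.hom.hom (f.hom.hom.hom v) = v at h1
    rw [← h1, hfx, hv, sub_self, map_zero]

lemma exists_sum_mul_character_eq {k : Type} [Field k] (d : k) {m : ℕ}
    (V : FDRep k (Perm (Fin (m + 1)))) [Simple V] :
    ∃ c : k, ∀ g, ∑ h, V.character (g * h) * d ^ (numCycles h - 1) = c * V.character g := by
  obtain ⟨c, hc⟩ := exists_cycleSum_eq_smul d V
  refine ⟨c, fun g => ?_⟩
  have := congrArg (fun f => LinearMap.trace k V (V.ρ g * f)) hc
  simpa [cycleSum, Finset.mul_sum, ← map_mul, FDRep.character, mul_comm] using this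

lemma exists_sum_character_mul_eq {k : Type} [Field k] (d : k) {m : ℕ}
    (V : FDRep k (Perm (Fin (m + 1)))) [Simple V] :
    ∃ c : k, ∀ g, ∑ h, V.character h * d ^ (numCycles (g * h) - 1) = c * V.character g⁻¹ := by
  obtain ⟨c, hc⟩ := exists_sum_mul_character_eq d V
  refine ⟨c, fun g => ?_⟩
  rw [← hc, ← Equiv.sum_comp (Equiv.mulLeft g) fun h => V.character (g⁻¹ * h) * _]
  simp

end JucysMurphy

section PartialTrace

variable [SymmetricCategory C]

/-- The pairing `U ⊗ U' ⟶ 𝟙` obtained from the evaluation by means of the symmetry. -/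
def coEv (U U' : C) [ExactPairing U U'] : U ⊗ U' ⟶ 𝟙_ C :=
  (β_ U U').hom ≫ ε_ U U'

/-- The partial trace computed with an arbitrary dual `U'` of `U`. -/
def ptraceWith (A B U U' : C) [ExactPairing U U'] (f : A ⊗ U ⟶ B ⊗ U) : A ⟶ B :=
  (ρ_ A).inv ≫ A ◁ η_ U U' ≫ (α_ A U U').inv ≫ f ▷ U' ≫ (α_ B U U').hom ≫
    B ◁ coEv U U' ≫ (ρ_ B).hom

lemma ptrace_eq_ptraceWith [RigidCategory C] (A B U : C) (f : A ⊗ U ⟶ B ⊗ U) :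
    ptrace A B U f = ptraceWith A B U (Uᘁ) f := rfl

lemma ptraceWith_whiskerLeft_comp {A B U U' W W' : C} [ExactPairing U U'] [ExactPairing W W']
    (g : U ⟶ W) (f : A ⊗ W ⟶ B ⊗ U) :
    ptraceWith A B U U' (A ◁ g ≫ f) = ptraceWith A B W W' (f ≫ B ◁ g) := by
  obtain ⟨g', hη, hε⟩ : ∃ g' : W' ⟶ U', η_ U U' ≫ g ▷ U' = η_ W W' ≫ W ◁ g' ∧
      g' ▷ U ≫ ε_ U U' = W' ◁ g ≫ ε_ W W' := by
    let _ : HasRightDual U := ⟨U'⟩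
    let _ : HasRightDual W := ⟨W'⟩
    exact ⟨gᘁ, (coevaluation_comp_rightAdjointMate g).symm, rightAdjointMate_comp_evaluation g⟩
  have hev : U ◁ g' ≫ coEv U U' = g ▷ W' ≫ coEv W W' := by
    rw [coEv, coEv, BraidedCategory.braiding_naturality_right_assoc, hε,
      BraidedCategory.braiding_naturality_left_assoc]
  have h1 : A ◁ η_ U U' ≫ (α_ A U U').inv ≫ (A ◁ g) ▷ U' =
      A ◁ η_ W W' ≫ (α_ A W W').inv ≫ (A ⊗ W) ◁ g' := by
    rw [← associator_inv_naturality_middle, ← associator_inv_naturality_right,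
      ← whiskerLeft_comp_assoc, ← whiskerLeft_comp_assoc, hη]
  simp only [ptraceWith, comp_whiskerRight, Category.assoc]
  rw [reassoc_of% h1, whisker_exchange_assoc, associator_naturality_right_assoc,
    associator_naturality_middle_assoc, ← whiskerLeft_comp_assoc, ← whiskerLeft_comp_assoc, hev]

lemma ptraceWith_eq_ptraceWith {A B U U₁ U₂ : C} [ExactPairing U U₁] [ExactPairing U U₂]
    (f : A ⊗ U ⟶ B ⊗ U) : ptraceWith A B U U₁ f = ptraceWith A B U U₂ f := by
  simpa using ptraceWith_whiskerLeft_comp (U' := U₁) (W' := U₂) (𝟙 U) f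

lemma ptraceWith_comp_whiskerRight {A B B' U U' : C} [ExactPairing U U'] (b : B ⟶ B')
    (f : A ⊗ U ⟶ B ⊗ U) :
    ptraceWith A B' U U' (f ≫ b ▷ U) = ptraceWith A B U U' f ≫ b := by
  simp only [ptraceWith, comp_whiskerRight, Category.assoc]
  rw [associator_naturality_left_assoc, ← whisker_exchange_assoc, rightUnitor_naturality]

lemma ptraceWith_whiskerLeft {A B U U' : C} [ExactPairing U U'] (Z : C) (f : A ⊗ U ⟶ B ⊗ U) :
    ptraceWith (Z ⊗ A) (Z ⊗ B) U U' ((α_ Z A U).hom ≫ Z ◁ f ≫ (α_ Z B U).inv) =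
      Z ◁ ptraceWith A B U U' f := by
  simp only [ptraceWith]
  monoidal

lemma ptraceWith_braiding (X X' : C) [ExactPairing X X'] :
    ptraceWith X X X X' (β_ X X).hom = 𝟙 X := by
  have h1 : (α_ X X X').inv ≫ (β_ X X).hom ▷ X' ≫ (α_ X X X').hom ≫ X ◁ (β_ X X').hom =
      (β_ X (X ⊗ X')).hom ≫ (α_ X X' X).hom := by
    rw [BraidedCategory.braiding_tensor_right_hom]
    simp
  rw [ptraceWith, coEv, whiskerLeft_comp_assoc, reassoc_of% h1,
    BraidedCategory.braiding_naturality_right_assoc]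
  have := ExactPairing.evaluation_coevaluation X X'
  rw [reassoc_of% this]
  simp

lemma ptraceWith_id (A U U' : C) [ExactPairing U U'] :
    ptraceWith A A U U' (𝟙 _) = (ρ_ A).inv ≫ A ◁ (η_ U U' ≫ coEv U U') ≫ (ρ_ A).hom := by
  simp [ptraceWith]

lemma whiskerLeft_braiding_comp_coEv (U U' Z : C) [ExactPairing U U'] :
    U ◁ (β_ U' Z).hom ≫ (α_ U Z U').inv ≫ (β_ U Z).hom ▷ U' ≫ (α_ Z U U').hom ≫ Z ◁ coEv U U' =
      (α_ U U' Z).inv ≫ coEv U U' ▷ Z ≫ (λ_ Z).hom ≫ (ρ_ Z).inv := by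
  have h := BraidedCategory.braiding_naturality_left (coEv U U') Z
  rw [BraidedCategory.braiding_tensor_left_hom, braiding_tensorUnit_left] at h
  simp only [Category.assoc] at h
  rw [h, Iso.inv_hom_id_assoc]

lemma braiding_whiskerRight_comp_coEv (U U' Z : C) [ExactPairing U U'] :
    (β_ U Z).hom ▷ U' ≫ (α_ Z U U').hom ≫ Z ◁ coEv U U' =
      (α_ U Z U').hom ≫ U ◁ (β_ Z U').hom ≫ (α_ U U' Z).inv ≫ coEv U U' ▷ Z ≫
        (λ_ Z).hom ≫ (ρ_ Z).inv := by
  rw [← whiskerLeft_braiding_comp_coEv, ← whiskerLeft_comp_assoc, SymmetricCategory.symmetry,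
    whiskerLeft_id, Category.id_comp, Iso.hom_inv_id_assoc]

lemma braiding_comp_evaluation (W W' Z : C) [ExactPairing W W'] :
    (β_ W (W' ⊗ Z)).hom ≫ (β_ W' Z).hom ▷ W ≫ (α_ Z W' W).hom ≫ Z ◁ ε_ W W' =
      (α_ W W' Z).inv ≫ coEv W W' ▷ Z ≫ (λ_ Z).hom ≫ (ρ_ Z).inv := by
  rw [← whiskerLeft_braiding_comp_coEv, ← BraidedCategory.braiding_naturality_right_assoc,
    BraidedCategory.braiding_tensor_right_hom, coEv]
  simp

lemma coEv_tensor (U W U' W' : C) [ExactPairing U U'] [ExactPairing W W'] :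
    coEv (U ⊗ W) (W' ⊗ U') = 𝟙 _ ⊗≫ U ◁ coEv W W' ▷ U' ⊗≫ coEv U U' := by
  have h1 := braiding_whiskerRight_comp_coEv U U' W'
  have h2 := braiding_comp_evaluation W W' U'
  calc coEv (U ⊗ W) (W' ⊗ U')
      = 𝟙 _ ⊗≫ U ◁ (β_ W (W' ⊗ U')).hom ⊗≫
          ((β_ U W').hom ▷ U' ≫ (α_ W' U U').hom ≫ W' ◁ coEv U U') ▷ W ⊗≫ ε_ W W' := by
        rw [coEv, BraidedCategory.braiding_tensor_left_hom,
          BraidedCategory.braiding_tensor_right_hom U, ExactPairing.tensor_evaluation, coEv]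
        monoidal
    _ = 𝟙 _ ⊗≫ U ◁ ((β_ W (W' ⊗ U')).hom ≫ (β_ W' U').hom ▷ W) ⊗≫
          (coEv U U' ▷ (W' ⊗ W) ≫ 𝟙_ C ◁ ε_ W W') ⊗≫ 𝟙 _ := by
        rw [h1]
        monoidal
    _ = 𝟙 _ ⊗≫ U ◁ ((β_ W (W' ⊗ U')).hom ≫ (β_ W' U').hom ▷ W ≫ (α_ U' W' W).hom ≫
          U' ◁ ε_ W W') ⊗≫ coEv U U' := by
        rw [← whisker_exchange]
        monoidal
    _ = _ := by
        rw [h2]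
        monoidal

lemma ptraceWith_tensor {A B U U' W W' : C} [ExactPairing U U'] [ExactPairing W W']
    (f : A ⊗ U ⊗ W ⟶ B ⊗ U ⊗ W) :
    ptraceWith A B (U ⊗ W) (W' ⊗ U') f = ptraceWith A B U U'
      (ptraceWith (A ⊗ U) (B ⊗ U) W W' ((α_ A U W).hom ≫ f ≫ (α_ B U W).inv)) := by
  rw [ptraceWith, coEv_tensor, ExactPairing.tensor_coevaluation]
  simp only [ptraceWith]
  monoidal

variable [RigidCategory C]

lemma ptrace_whiskerLeft_comp {A B U W : C} (g : U ⟶ W) (f : A ⊗ W ⟶ B ⊗ U) :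
    ptrace A B U (A ◁ g ≫ f) = ptrace A B W (f ≫ B ◁ g) :=
  ptraceWith_whiskerLeft_comp g f

lemma ptrace_unit_id (A : C) : ptrace A A (𝟙_ C) (𝟙 _) = 𝟙 A := by
  rw [ptrace_eq_ptraceWith, ptraceWith_eq_ptraceWith (U₂ := 𝟙_ C), ptraceWith_id]
  have : η_ (𝟙_ C) (𝟙_ C) ≫ coEv (𝟙_ C) (𝟙_ C) = 𝟙 (𝟙_ C) := by
    change (ρ_ (𝟙_ C)).inv ≫ (β_ (𝟙_ C) (𝟙_ C)).hom ≫ (ρ_ (𝟙_ C)).hom = 𝟙 (𝟙_ C)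
    rw [braiding_tensorUnit_left]
    simp [unitors_equal]
  rw [this]
  simp

lemma ptrace_tensor {A B U W : C} (f : A ⊗ U ⊗ W ⟶ B ⊗ U ⊗ W) :
    ptrace A B (U ⊗ W) f =
      ptrace A B U (ptrace (A ⊗ U) (B ⊗ U) W ((α_ A U W).hom ≫ f ≫ (α_ B U W).inv)) := by
  simp only [ptrace_eq_ptraceWith]
  rw [ptraceWith_eq_ptraceWith (U₂ := Wᘁ ⊗ Uᘁ), ptraceWith_tensor]

end PartialTrace

section StandardPermutations

open Equiv

/-- The endomorphisms of `X^{⊗m}` acting on the last `m` factors of `X^{⊗(m+1)}`. -/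
def tpowWhisker (X : C) (m : ℕ) :
    CategoryTheory.End (tpow X m) →* CategoryTheory.End (tpow X (m + 1)) where
  toFun f := X ◁ f
  map_one' := whiskerLeft_id _ _
  map_mul' f g := whiskerLeft_comp _ g f

/-- Permutations of the following form, together with the endomorphisms of `X^{⊗(m+1)}` through
which they act: `σ ↦ embSucc σ` and `σ ↦ (0 1) (embSucc σ)`, starting from the identity of one
point. They represent all conjugacy classes. -/
inductive IsStandardPerm [BraidedCategory C] (X : C) :
    (m : ℕ) → Perm (Fin (m + 1)) → (tpow X (m + 1) ⟶ tpow X (m + 1)) → Prop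
  | one : IsStandardPerm X 0 1 (𝟙 _)
  | embSucc {m : ℕ} {σ : Perm (Fin (m + 1))} {h : tpow X (m + 1) ⟶ tpow X (m + 1)} :
      IsStandardPerm X m σ h → IsStandardPerm X (m + 1) (embSucc (m + 1) σ) (X ◁ h)
  | swap_mul {m : ℕ} {σ : Perm (Fin (m + 1))} {h : tpow X (m + 1) ⟶ tpow X (m + 1)} :
      IsStandardPerm X m σ h → IsStandardPerm X (m + 1) (swap 0 1 * _root_.embSucc (m + 1) σ)
        (X ◁ h ≫ adjSwap X (m + 2) 0)

lemma IsStandardPerm.map_eq [BraidedCategory C] {X Z : C} {m : ℕ} {σ : Perm (Fin (m + 1))}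
    {h : tpow X (m + 1) ⟶ tpow X (m + 1)} (hσ : IsStandardPerm X m σ h)
    (φ : Perm (Fin (m + 1)) →* CategoryTheory.End Z)
    (F : CategoryTheory.End (tpow X (m + 1)) →* CategoryTheory.End Z)
    (hφ : ∀ (i : ℕ) (hi : i + 1 < m + 1),
      φ (swap ⟨i, Nat.lt_of_succ_lt hi⟩ ⟨i + 1, hi⟩) = F (adjSwap X (m + 1) i)) :
    φ σ = F h := by
  induction hσ generalizing Z with
  | one => exact (map_one φ).trans (map_one F).symm
  | @embSucc m σ h _ ih =>
    refine ih (φ.comp (_root_.embSucc (m + 1))) (F.comp (tpowWhisker X _)) fun i hi => ?_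
    rw [MonoidHom.comp_apply, Perm.embSucc_swap]
    exact hφ (i + 1) (by omega)
  | @swap_mul m σ h _ ih =>
    have := ih (φ.comp (_root_.embSucc (m + 1))) (F.comp (tpowWhisker X _)) fun i hi => by
      rw [MonoidHom.comp_apply, Perm.embSucc_swap]
      exact hφ (i + 1) (by omega)
    rw [MonoidHom.comp_apply] at this
    rw [map_mul, this]
    let a : CategoryTheory.End (tpow X (m + 2)) := adjSwap X (m + 2) 0
    exact (congrArg (· * _) (hφ 0 (by omega))).trans (map_mul F a _).symm

lemma exists_isStandardPerm [BraidedCategory C] (X : C) {m : ℕ} (σ : Perm (Fin (m + 1))) :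
    ∃ (τ : Perm (Fin m)) (c : Perm (Fin (m + 1))) (h : tpow X (m + 1) ⟶ tpow X (m + 1)),
      IsStandardPerm X m c h ∧ σ = embSucc m τ * c * (embSucc m τ)⁻¹ := by
  induction m with
  | zero => exact ⟨1, 1, 𝟙 _, .one, Equiv.ext fun x => Subsingleton.elim (α := Fin 1) _ _⟩
  | succ m ih =>
    obtain ⟨⟨p, e⟩, rfl⟩ := Perm.decomposeFin.symm.surjective σ
    rw [Perm.decomposeFin_symm_eq_swap_mul]
    refine Fin.cases ?_ (fun i => ?_) p
    · obtain ⟨τ, c, h, hc, rfl⟩ := ih e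
      exact ⟨embSucc m τ, _, _, hc.embSucc, by simp [← Perm.one_def]⟩
    · obtain ⟨t, ht⟩ : ∃ t : Perm (Fin (m + 1)), t = swap 0 i := ⟨_, rfl⟩
      obtain ⟨τ, c, h, hc, he⟩ := ih (t⁻¹ * e * t)
      refine ⟨t * embSucc m τ, _, _, hc.swap_mul, ?_⟩
      have h1 : swap 0 i.succ = embSucc (m + 1) t * swap 0 1 * (embSucc (m + 1) t)⁻¹ := by
        rw [← swap_apply_apply, Perm.embSucc_apply_zero, ← Fin.succ_zero_eq_one,
          Perm.embSucc_apply_succ, ht, swap_apply_left]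
      have h2 : Commute (embSucc (m + 1) (embSucc m τ)) (swap 0 1) := by
        have := swap_apply_apply (embSucc (m + 1) (embSucc m τ)) 0 1
        rw [Perm.embSucc_apply_zero, ← Fin.succ_zero_eq_one, Perm.embSucc_apply_succ,
          Perm.embSucc_apply_zero] at this
        exact (eq_mul_inv_iff_mul_eq.1 this).symm
      have h3 : e = t * (embSucc m τ * c * (embSucc m τ)⁻¹) * t⁻¹ := by
        rw [← he]; group
      rw [h1, h3]
      simp only [map_mul, map_inv, mul_inv_rev, mul_assoc, inv_mul_cancel_left, h2.left_comm]

end StandardPermutations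

section PermutationTrace

open Equiv

variable {k : Type*} [Field k] [Preadditive C] [Linear k C] [MonoidalPreadditive C]
  [MonoidalLinear k C] [SymmetricCategory C]

lemma ptraceWith_smul (A B U U' : C) [ExactPairing U U'] (a : k) (f : A ⊗ U ⟶ B ⊗ U) :
    ptraceWith A B U U' (a • f) = a • ptraceWith A B U U' f := by
  simp [ptraceWith]

lemma ptraceWith_sum (A B U U' : C) [ExactPairing U U'] {ι : Type*} (s : Finset ι)
    (f : ι → (A ⊗ U ⟶ B ⊗ U)) :
    ptraceWith A B U U' (∑ i ∈ s, f i) = ∑ i ∈ s, ptraceWith A B U U' (f i) := by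
  simp [ptraceWith, Preadditive.sum_comp, Preadditive.comp_sum, sum_whiskerRight]

lemma ptrace_smul_sum_comp [RigidCategory C] {A B U : C} {ι κ : Type*} [Fintype ι] [Fintype κ]
    (a b : k) (x : ι → k) (y : κ → k) (f : ι → (A ⊗ U ⟶ B ⊗ U)) (g : κ → (U ⟶ U)) :
    ptrace A B U ((a • ∑ i, x i • f i) ≫ B ◁ (b • ∑ j, y j • g j)) =
      (a * b) • ∑ j, y j • ∑ i, x i • ptrace A B U (f i ≫ B ◁ g j) := by
  simp only [ptrace_eq_ptraceWith, MonoidalLinear.whiskerLeft_smul, Linear.comp_smul,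
    Linear.smul_comp, whiskerLeft_sum, Preadditive.comp_sum, Preadditive.sum_comp,
    ptraceWith_smul, ptraceWith_sum, Finset.smul_sum, smul_smul]
  exact Finset.sum_congr rfl fun j _ => Finset.sum_congr rfl fun i _ => by congr 1; ring

lemma ptraceWith_id_eq_smul {U U' : C} [ExactPairing U U'] {d : k}
    (hd : η_ U U' ≫ coEv U U' = d • 𝟙 (𝟙_ C)) (A : C) :
    ptraceWith A A U U' (𝟙 _) = d • 𝟙 A := by
  rw [ptraceWith_id, hd]
  simp

variable [RigidCategory C]

lemma ptrace_whiskerLeft {X T : C} {d : k} (hd : η_ X (Xᘁ) ≫ coEv X (Xᘁ) = d • 𝟙 (𝟙_ C))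
    {h : X ⊗ T ⟶ X ⊗ T} {a : k} (hh : ptrace X X T h = a • 𝟙 X) :
    ptrace X X (X ⊗ T) (X ◁ h) = (a * d) • 𝟙 X := by
  rw [ptrace_eq_ptraceWith] at hh
  rw [ptrace_tensor, ptrace_eq_ptraceWith, ptrace_eq_ptraceWith]
  rw [ptraceWith_whiskerLeft, hh, MonoidalLinear.whiskerLeft_smul, whiskerLeft_id,
    ptraceWith_smul, ptraceWith_id_eq_smul hd, smul_smul]

lemma ptrace_whiskerLeft_comp_braiding {X T : C} {h : X ⊗ T ⟶ X ⊗ T} {a : k}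
    (hh : ptrace X X T h = a • 𝟙 X) :
    ptrace X X (X ⊗ T) (X ◁ h ≫ (α_ X X T).inv ≫ (β_ X X).hom ▷ T ≫ (α_ X X T).hom) =
      a • 𝟙 X := by
  have h1 : (α_ X X T).hom ≫ (X ◁ h ≫ (α_ X X T).inv ≫ (β_ X X).hom ▷ T ≫ (α_ X X T).hom) ≫
      (α_ X X T).inv = ((α_ X X T).hom ≫ X ◁ h ≫ (α_ X X T).inv) ≫ (β_ X X).hom ▷ T := by
    simp
  rw [ptrace_eq_ptraceWith] at hh
  rw [ptrace_tensor, ptrace_eq_ptraceWith, ptrace_eq_ptraceWith]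
  rw [h1, ptraceWith_comp_whiskerRight, ptraceWith_whiskerLeft, hh,
    MonoidalLinear.whiskerLeft_smul, whiskerLeft_id, Linear.smul_comp, Category.id_comp,
    ptraceWith_smul, ptraceWith_braiding]

lemma IsStandardPerm.ptrace_eq {X : C} {d : k}
    (hd : η_ X (Xᘁ) ≫ coEv X (Xᘁ) = d • 𝟙 (𝟙_ C)) {m : ℕ} {σ : Perm (Fin (m + 1))}
    {h : tpow X (m + 1) ⟶ tpow X (m + 1)} (hσ : IsStandardPerm X m σ h) :
    ptrace X X (tpow X m) h = d ^ (numCycles σ - 1) • 𝟙 X := by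
  induction hσ with
  | one => exact (ptrace_unit_id X).trans (by simp [numCycles])
  | @embSucc m σ h _ ih =>
    refine (ptrace_whiskerLeft hd ih).trans ?_
    have := Perm.numCycles_pos σ
    rw [← pow_succ, Perm.numCycles_embSucc]
    congr 2
    omega
  | @swap_mul m σ h _ ih =>
    refine (ptrace_whiskerLeft_comp_braiding ih).trans ?_
    have := Perm.numCycles_swap_mul_embSucc 0 σ
    rw [Fin.succ_zero_eq_one] at this
    rw [this]

end PermutationTrace

section PermutationAction

open Equiv

lemma IsPermAction.map_embSucc [BraidedCategory C] {X : C} {m : ℕ}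
    {ρ : Perm (Fin (m + 1)) →* CategoryTheory.End (tpow X (m + 1))}
    (hρ : IsPermAction X (m + 1) ρ) {ρ' : Perm (Fin m) →* CategoryTheory.End (tpow X m)}
    (hρ' : IsPermAction X m ρ') (τ : Perm (Fin m)) : ρ (embSucc m τ) = X ◁ ρ' τ := by
  cases m with
  | zero =>
    rw [Subsingleton.elim τ 1, map_one, map_one, map_one]
    exact (whiskerLeft_id _ _).symm
  | succ m =>
    have : ρ.comp (embSucc (m + 1)) = (tpowWhisker X (m + 1)).comp ρ' := by
      refine MonoidHom.eq_of_eqOn_denseM (Perm.mclosure_swap_castSucc_succ m) ?_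
      rintro _ ⟨i, rfl⟩
      rw [MonoidHom.comp_apply, MonoidHom.comp_apply, Perm.embSucc_swap]
      exact (hρ (i + 1) (by omega)).trans
        (congrArg (tpowWhisker X (m + 1)) (hρ' i (by omega))).symm
    exact DFunLike.congr_fun this τ

lemma ptrace_perm {k : Type*} [Field k] [Preadditive C] [Linear k C] [MonoidalPreadditive C]
    [MonoidalLinear k C] [SymmetricCategory C] [RigidCategory C] {X : C} {d : k}
    (hd : η_ X (Xᘁ) ≫ coEv X (Xᘁ) = d • 𝟙 (𝟙_ C)) {m : ℕ}
    {ρ : Perm (Fin (m + 1)) →* CategoryTheory.End (tpow X (m + 1))}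
    (hρ : IsPermAction X (m + 1) ρ) {ρ' : Perm (Fin m) →* CategoryTheory.End (tpow X m)}
    (hρ' : IsPermAction X m ρ') (σ : Perm (Fin (m + 1))) :
    ptrace X X (tpow X m) (ρ σ) = d ^ (numCycles σ - 1) • 𝟙 X := by
  obtain ⟨τ, c, h, hc, rfl⟩ := exists_isStandardPerm X σ
  have hρc : ρ c = h := hc.map_eq ρ (MonoidHom.id _) hρ
  have h1 : ρ (embSucc m τ * c * (embSucc m τ)⁻¹) = X ◁ (ρ' τ⁻¹) ≫ (h ≫ X ◁ (ρ' τ)) := by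
    rw [← map_inv, map_mul, map_mul, hρ.map_embSucc hρ', hρ.map_embSucc hρ', hρc]
    rfl
  have h2 : (X ◁ ρ' τ) ≫ (X ◁ ρ' τ⁻¹) = 𝟙 (X ⊗ tpow X m) := by
    rw [← whiskerLeft_comp]
    refine (congrArg (X ◁ ·) ((map_mul ρ' τ⁻¹ τ).symm.trans ?_)).trans (whiskerLeft_id _ _)
    rw [inv_mul_cancel, map_one]
    rfl
  rw [Perm.numCycles_conj]
  refine (congrArg _ h1).trans ((ptrace_whiskerLeft_comp _ _).trans ?_)
  refine (congrArg _ ((Category.assoc _ _ _).trans ?_)).trans (hc.ptrace_eq hd)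
  exact (congrArg (h ≫ ·) h2).trans (Category.comp_id _)

end PermutationAction

/-- Let `k` be a field of characteristic `0` or `> m+1`, let `C` be
a `k`-linear symmetric rigid monoidal category with `End (𝟙_ C) = k`, and let `X : C`
have dimension `d = ẽv_X ∘ coev_X ∈ k`.  View `X^{⊗(m+1)}` as `X ⊗ X^{⊗m}`, and let
`ρ`, `ρ'` be the actions of `S_{m+1}` and `S_m` (the stabilizer of the first point)
on `X^{⊗(m+1)}` and `X^{⊗m}` permuting tensor factors via the symmetry.  Let `Vα`,
`Vβ` be irreducible representations of `S_m`, `S_{m+1}` with characters `χα`, `χβ`,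
whose associated primitive central idempotents are
`e_α = (dim Vα / m!) ∑_τ χα(τ) τ` and `e_β = (dim Vβ / (m+1)!) ∑_σ χβ(σ) σ`, and assume
the multiplicity of `Vα` in the restriction of `Vβ` equals `1`, i.e.
`(1/m!) ∑_τ χα(τ) χβ(τ⁻¹) = 1`.  Then
`Tr^{X^{⊗m}}_{X,X}((id_X ⊗ ρ'(e_α)) ∘ ρ(e_β))
  = ((dim Vα / (m+1)!) ∑_σ χβ(σ) d^{N(σ)-1}) • id_X`. -/
theorem ptrace_idempotents
    {k : Type} [Field k] [Preadditive C] [Linear k C]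
    [MonoidalPreadditive C] [MonoidalLinear k C]
    [SymmetricCategory C] [RigidCategory C]
    (m : ℕ) (hchar : ringChar k = 0 ∨ m + 1 < ringChar k)
    (hEnd : Function.Bijective (fun a : k => a • (𝟙 (𝟙_ C))))
    (X : C) (d : k)
    (hd : η_ X (Xᘁ) ≫ (β_ X (Xᘁ)).hom ≫ ε_ X (Xᘁ) = d • 𝟙 (𝟙_ C))
    (ρ : Equiv.Perm (Fin (m + 1)) →* CategoryTheory.End (tpow X (m + 1)))
    (hρ : IsPermAction X (m + 1) ρ)
    (ρ' : Equiv.Perm (Fin m) →* CategoryTheory.End (tpow X m))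
    (hρ' : IsPermAction X m ρ')
    (Vα : FDRep k (Equiv.Perm (Fin m))) [Simple Vα]
    (Vβ : FDRep k (Equiv.Perm (Fin (m + 1)))) [Simple Vβ]
    (hmult : (1 / (Nat.factorial m : k)) *
        ∑ τ : Equiv.Perm (Fin m), Vα.character τ * Vβ.character (embSucc m τ⁻¹) = 1) :
    ptrace X X (tpow X m)
        ((((Module.finrank k Vβ : k) / (Nat.factorial (m + 1) : k)) •
            ∑ σ : Equiv.Perm (Fin (m + 1)),
              Vβ.character σ • (ρ σ : tpow X (m + 1) ⟶ tpow X (m + 1))) ≫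
          (X ◁ (((Module.finrank k Vα : k) / (Nat.factorial m : k)) •
            ∑ τ : Equiv.Perm (Fin m),
              Vα.character τ • (ρ' τ : tpow X m ⟶ tpow X m)))) =
      (((Module.finrank k Vα : k) / (Nat.factorial (m + 1) : k)) *
        ∑ σ : Equiv.Perm (Fin (m + 1)),
          Vβ.character σ * d ^ (numCycles σ - 1)) • 𝟙 X := by
  have hd' : η_ X (Xᘁ) ≫ coEv X (Xᘁ) = d • 𝟙 (𝟙_ C) := hd
  have htr (σ : Equiv.Perm (Fin (m + 1))) (τ : Equiv.Perm (Fin m)) :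
      ptrace X X (tpow X m)
        ((ρ σ : tpow X (m + 1) ⟶ tpow X (m + 1)) ≫ X ◁ (ρ' τ : tpow X m ⟶ tpow X m)) =
        d ^ (numCycles (embSucc m τ * σ) - 1) • 𝟙 X := by
    rw [← ptrace_perm hd' hρ hρ', map_mul, hρ.map_embSucc hρ']
    rfl
  obtain ⟨c, hc⟩ := exists_sum_character_mul_eq d Vβ
  have hdim : ∑ σ, Vβ.character σ * d ^ (numCycles σ - 1) = c * Module.finrank k Vβ := by
    simpa using hc 1
  have hsum : ∑ τ, Vα.character τ * (c * Vβ.character (embSucc m τ⁻¹)) =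
      c * ∑ τ, Vα.character τ * Vβ.character (embSucc m τ⁻¹) := by
    rw [Finset.mul_sum]
    exact Finset.sum_congr rfl fun τ _ => mul_left_comm _ _ _
  have hLHS : ∑ τ, Vα.character τ • ∑ σ, Vβ.character σ •
      ptrace X X (tpow X m)
        ((ρ σ : tpow X (m + 1) ⟶ tpow X (m + 1)) ≫ X ◁ (ρ' τ : tpow X m ⟶ tpow X m)) =
      (c * ∑ τ, Vα.character τ * Vβ.character (embSucc m τ⁻¹)) • 𝟙 X := by
    simp only [htr, smul_smul, ← Finset.sum_smul, hc, ← map_inv, hsum]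
  refine (ptrace_smul_sum_comp _ _ _ _ _ _).trans ((congrArg _ hLHS).trans ?_)
  rw [smul_smul, hdim]
  congr 1
  linear_combination (Module.finrank k Vα / (Nat.factorial (m + 1) : k) * c *
    Module.finrank k Vβ) * hmult
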